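/- Let m ≥ 2 and let (A¹, …, A^m) be a Markov m-player positive unit-sphere game (normalized so that each fiber sum equals 1) with δ_k > (m − 2)/(m − 1) for every k. Let x* be the tuple of ℓ1-normalized strategies of the unique Nash equilibrium. Start the Cournot adjustment from the uniform profile x_k⁰ = (1/n_k, …, 1/n_k) and iterate x_k^t = f(x^{t−1})_k, where f(x)_{k,i_k} = Σ_{(i_j)_{j≠k}} A^k_{i₁,…,i_m} ∏_{j≠k} x_{j,i_j}. Then with δ = max_k (1 − δ_k) and ε₀ = max_k ‖x_k⁰ − x_k*‖₁, for every t ≥ 0, max_k ‖x_k^t − x_k*‖₁ ≤ (m − 1)^t · δ^t · ε₀; since (m−1)δ < 1, the iterates converge to x* with exponentially decreasing error. -/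

import Mathlib

open Finset

/-- Player's payoff in an `m`-player unit-sphere game. -/
def tensorPayoff {m : ℕ} {n : Fin m → ℕ} (T : (∀ j, Fin (n j)) → ℝ)
    (x : ∀ j, Fin (n j) → ℝ) : ℝ :=
  ∑ i : ∀ j, Fin (n j), T i * ∏ j, x j (i j)

/-- The marginal (expected-payoff) vector of player `k`. -/
def tensorMarginal {m : ℕ} {n : Fin m → ℕ} (T : (∀ j, Fin (n j)) → ℝ)
    (x : ∀ j, Fin (n j) → ℝ) (k : Fin m) (b : Fin (n k)) : ℝ :=
  ∑ i : ∀ j, Fin (n j),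
    if i k = b then T i * ∏ j ∈ Finset.univ.erase k, x j (i j) else 0

/-- `δ_k` of a payoff tensor `T` of player `k`. -/
noncomputable def tensorDelta {m : ℕ} {n : Fin m → ℕ}
    (T : (∀ j, Fin (n j)) → ℝ) (k : Fin m) : ℝ :=
  sInf (Set.range fun V : Finset (Fin (n k)) =>
    sInf (Set.range fun i : ∀ j, Fin (n j) =>
      ∑ b ∈ V, T (Function.update i k b)) +
    sInf (Set.range fun i : ∀ j, Fin (n j) =>
      ∑ b ∈ Vᶜ, T (Function.update i k b)))

/-- The `ℓ1` distance between product weights is at most the sum of the `ℓ1` distances between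
the factors. -/
lemma sum_abs_prod_sub_prod_le {ι : Type*} [Fintype ι] [LinearOrder ι] {α : ι → Type*}
    [∀ j, Fintype (α j)] {x y : ∀ j, α j → ℝ}
    (hx : ∀ j, x j ∈ stdSimplex ℝ (α j)) (hy : ∀ j, y j ∈ stdSimplex ℝ (α j)) :
    ∑ i : ∀ j, α j, |∏ j, x j (i j) - ∏ j, y j (i j)| ≤ ∑ j, ∑ a, |x j a - y j a| := by
  set h : ι → ∀ l, α l → ℝ := fun j l a =>
    if l = j then |x l a - y l a| else if l < j then y l a else x l a with hdef
  have hybrid (i : ∀ j, α j) (j : ι) :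
      ∏ l, h j l (i l) = |x j (i j) - y j (i j)| * (∏ l with l < j, y l (i l)) *
        ∏ l with j < l, x l (i l) := by
    rw [Finset.prod_filter, Finset.prod_filter, mul_assoc, ← Finset.prod_mul_distrib,
      ← Finset.prod_erase_mul _ _ (Finset.mem_univ j), mul_comm,
      ← Finset.prod_erase_mul _ (fun l => _ * _) (Finset.mem_univ j)]
    have hne : ∀ l ∈ Finset.univ.erase j, h j l (i l) =
        (if l < j then y l (i l) else 1) * if j < l then x l (i l) else 1 := by
      intro l hl
      rcases lt_or_gt_of_ne (Finset.ne_of_mem_erase hl) with hlt | hlt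
      · simp [hdef, hlt.ne, hlt, hlt.not_gt]
      · simp [hdef, hlt.ne', hlt, hlt.not_gt]
    rw [Finset.prod_congr rfl hne]
    simp [hdef]
  calc ∑ i : ∀ j, α j, |∏ j, x j (i j) - ∏ j, y j (i j)|
      ≤ ∑ i : ∀ j, α j, ∑ j, ∏ l, h j l (i l) := by
        refine Finset.sum_le_sum fun i _ => ?_
        have key := Finset.prod_sub_ordered Finset.univ (fun j => x j (i j))
          (fun j => x j (i j) - y j (i j))
        simp only [sub_sub_cancel] at key
        rw [key, sub_sub_cancel]
        refine (Finset.abs_sum_le_sum_abs _ _).trans (Finset.sum_le_sum fun j _ => ?_)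
        rw [hybrid, abs_mul, abs_mul, Finset.abs_prod, Finset.abs_prod]
        simp only [abs_of_nonneg ((hx _).1 _), abs_of_nonneg ((hy _).1 _), le_refl]
    _ = ∑ j, ∏ l, ∑ a, h j l a := by
        rw [Finset.sum_comm]
        refine Finset.sum_congr rfl fun j _ => ?_
        rw [Finset.prod_univ_sum, Fintype.piFinset_univ]
    _ = ∑ j, ∑ a, |x j a - y j a| := by
        refine Finset.sum_congr rfl fun j _ => ?_
        rw [Finset.prod_eq_single j]
        · simp [hdef]
        · intro l _ hl
          by_cases hlt : l < j
          · simpa [hdef, hl, hlt] using (hy l).2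
          · simpa [hdef, hl, hlt] using (hx l).2
        · simp

/-- A function of oscillation at most `D`, integrated against a signed weight of total mass
zero. -/
lemma sum_mul_le_half_oscillation {ι : Type*} [Fintype ι] {c d : ι → ℝ} {D : ℝ}
    (hc : ∀ i j, c i - c j ≤ D) (hd : ∑ i, d i = 0) :
    ∑ i, c i * d i ≤ D / 2 * ∑ i, |d i| := by
  rcases isEmpty_or_nonempty ι with h | h
  · simp
  obtain ⟨p, hp⟩ := Finite.exists_max c
  obtain ⟨q, hq⟩ := Finite.exists_min c
  have shift : ∑ i, c i * d i = ∑ i, (c i - (c p + c q) / 2) * d i := by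
    simp only [sub_mul, Finset.sum_sub_distrib, ← Finset.mul_sum, hd, mul_zero, sub_zero]
  rw [shift, Finset.mul_sum]
  refine Finset.sum_le_sum fun i _ => (le_abs_self _).trans ?_
  rw [abs_mul]
  refine mul_le_mul_of_nonneg_right (abs_le.2 ⟨?_, ?_⟩) (abs_nonneg _)
  · linarith [hq i, hc p q]
  · linarith [hp i, hc p q]

lemma sum_abs_eq_two_mul_sum_filter {ι : Type*} [Fintype ι] {d : ι → ℝ} (hd : ∑ i, d i = 0) :
    ∑ i, |d i| = 2 * ∑ i with 0 ≤ d i, d i := by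
  have h : ∑ i, |d i| = ∑ i, (2 * (if 0 ≤ d i then d i else 0) - d i) := by
    refine Finset.sum_congr rfl fun i _ => ?_
    split_ifs with hi
    · rw [abs_of_nonneg hi]; ring
    · rw [abs_of_neg (not_le.1 hi)]; ring
  rw [h, Finset.sum_sub_distrib, hd, sub_zero, ← Finset.mul_sum, Finset.sum_filter]

section Tensor

variable {m : ℕ} {n : Fin m → ℕ}

/-- The pure profile in which player `k` plays `b` and the others play `i`. -/
abbrev profileInsert (k : Fin m) (b : Fin (n k)) (i : ∀ j : {j // j ≠ k}, Fin (n j)) :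
    ∀ j, Fin (n j) :=
  (Equiv.piSplitAt k fun j => Fin (n j)).symm (b, i)

lemma update_profileInsert (k : Fin m) (a b : Fin (n k))
    (i : ∀ j : {j // j ≠ k}, Fin (n j)) :
    Function.update (profileInsert k a i) k b = profileInsert k b i := by
  ext j
  by_cases h : j = k
  · subst h; simp
  · simp [h]

lemma prod_erase_eq_prod_ne (k : Fin m) (f : Fin m → ℝ) :
    ∏ j ∈ Finset.univ.erase k, f j = ∏ j : {j // j ≠ k}, f j := by
  refine Finset.prod_subtype _ (fun j => ?_) f
  simp

lemma tensorMarginal_eq_sum (T : (∀ j, Fin (n j)) → ℝ) (x : ∀ j, Fin (n j) → ℝ) (k : Fin m)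
    (b : Fin (n k)) :
    tensorMarginal T x k b = ∑ i : ∀ j : {j // j ≠ k}, Fin (n j),
      T (profileInsert k b i) * ∏ j : {j // j ≠ k}, x j (i j) := by
  unfold tensorMarginal
  rw [← (Equiv.piSplitAt k fun j => Fin (n j)).symm.sum_comp, Fintype.sum_prod_type,
    Finset.sum_eq_single b]
  · refine Finset.sum_congr rfl fun i _ => ?_
    rw [if_pos (by simp), prod_erase_eq_prod_ne]
    congr 1
    refine Finset.prod_congr rfl fun j _ => ?_
    simp [j.2]
  · intro a _ hab
    exact Finset.sum_eq_zero fun i _ => if_neg (by simpa using hab)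
  · simp

lemma tensorPayoff_update (T : (∀ j, Fin (n j)) → ℝ) (x : ∀ j, Fin (n j) → ℝ) (k : Fin m)
    (z : Fin (n k) → ℝ) :
    tensorPayoff T (Function.update x k z) = ∑ b, tensorMarginal T x k b * z b := by
  unfold tensorPayoff tensorMarginal
  simp only [Finset.sum_mul]
  rw [Finset.sum_comm]
  refine Finset.sum_congr rfl fun i _ => ?_
  rw [Finset.sum_eq_single (i k) (fun b _ hb => by simp [hb.symm]) (by simp), if_pos rfl,
    ← Finset.prod_erase_mul _ _ (Finset.mem_univ k), Function.update_self, mul_assoc]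
  congr 2
  refine Finset.prod_congr rfl fun j hj => ?_
  rw [Function.update_of_ne (Finset.ne_of_mem_erase hj)]

lemma tensorMarginal_smul (T : (∀ j, Fin (n j)) → ℝ) (c : Fin m → ℝ) (x : ∀ j, Fin (n j) → ℝ)
    (k : Fin m) (b : Fin (n k)) :
    tensorMarginal T (fun j => c j • x j) k b =
      (∏ j ∈ Finset.univ.erase k, c j) * tensorMarginal T x k b := by
  unfold tensorMarginal
  rw [Finset.mul_sum]
  refine Finset.sum_congr rfl fun i _ => ?_
  split_ifs
  · simp only [Pi.smul_apply, smul_eq_mul, Finset.prod_mul_distrib]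
    ring
  · simp

lemma tensorDelta_le (T : (∀ j, Fin (n j)) → ℝ) (k : Fin m) (V : Finset (Fin (n k)))
    (i i' : ∀ j, Fin (n j)) :
    tensorDelta T k ≤ ∑ b ∈ V, T (Function.update i k b) +
      ∑ b ∈ Vᶜ, T (Function.update i' k b) :=
  (csInf_le (Set.finite_range _).bddBelow ⟨V, rfl⟩).trans <|
    add_le_add (csInf_le (Set.finite_range _).bddBelow ⟨i, rfl⟩)
      (csInf_le (Set.finite_range _).bddBelow ⟨i', rfl⟩)

variable {T : (∀ j, Fin (n j)) → ℝ} {k : Fin m}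

lemma sum_update_sub_sum_update_le
    (hT : ∀ i, ∑ b, T (Function.update i k b) = 1) (V : Finset (Fin (n k)))
    (i i' : ∀ j, Fin (n j)) :
    ∑ b ∈ V, T (Function.update i k b) - ∑ b ∈ V, T (Function.update i' k b) ≤
      1 - tensorDelta T k := by
  have h := tensorDelta_le T k V i' i
  have hsum := Finset.sum_add_sum_compl V fun b => T (Function.update i k b)
  rw [hT] at hsum
  linarith

lemma sum_profileInsert (hT : ∀ i, ∑ b, T (Function.update i k b) = 1)
    (hn : 0 < n k) (i : ∀ j : {j // j ≠ k}, Fin (n j)) :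
    ∑ b, T (profileInsert k b i) = 1 := by
  simpa only [update_profileInsert] using hT (profileInsert k ⟨0, hn⟩ i)

lemma sum_prod_eq_one {x : ∀ j, Fin (n j) → ℝ} (hx : ∀ j, x j ∈ stdSimplex ℝ (Fin (n j)))
    (k : Fin m) :
    ∑ i : ∀ j : {j // j ≠ k}, Fin (n j), ∏ j : {j // j ≠ k}, x j (i j) = 1 := by
  have h := Finset.prod_univ_sum (fun j : {j // j ≠ k} => (Finset.univ : Finset (Fin (n j))))
    (fun j a => x j a)
  rw [Fintype.piFinset_univ] at h
  rw [← h]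
  exact Finset.prod_eq_one fun j _ => (hx j).2

lemma tensorMarginal_mem_stdSimplex (hpos : ∀ i, 0 < T i)
    (hT : ∀ i, ∑ b, T (Function.update i k b) = 1) (hn : 0 < n k)
    {x : ∀ j, Fin (n j) → ℝ} (hx : ∀ j, x j ∈ stdSimplex ℝ (Fin (n j))) :
    tensorMarginal T x k ∈ stdSimplex ℝ (Fin (n k)) := by
  refine ⟨fun b => ?_, ?_⟩
  · rw [tensorMarginal_eq_sum]
    exact Finset.sum_nonneg fun i _ =>
      mul_nonneg (hpos _).le (Finset.prod_nonneg fun j _ => (hx j).1 _)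
  · simp only [tensorMarginal_eq_sum]
    rw [Finset.sum_comm]
    simp only [← Finset.sum_mul, sum_profileInsert hT hn, one_mul, sum_prod_eq_one hx]

lemma one_sub_tensorDelta_nonneg (hT : ∀ i, ∑ b, T (Function.update i k b) = 1)
    (hn : ∀ j, 0 < n j) : 0 ≤ 1 - tensorDelta T k := by
  simpa using sum_update_sub_sum_update_le hT ∅ (fun j => ⟨0, hn j⟩) fun j => ⟨0, hn j⟩

/-- The marginal map of a normalized Markov game is `(1 - δ_k)`-Lipschitz in `ℓ1`. -/
lemma sum_abs_tensorMarginal_sub_le (hpos : ∀ i, 0 < T i)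
    (hT : ∀ i, ∑ b, T (Function.update i k b) = 1) (hn : ∀ j, 0 < n j)
    {x y : ∀ j, Fin (n j) → ℝ} (hx : ∀ j, x j ∈ stdSimplex ℝ (Fin (n j)))
    (hy : ∀ j, y j ∈ stdSimplex ℝ (Fin (n j))) :
    ∑ b, |tensorMarginal T x k b - tensorMarginal T y k b| ≤
      (1 - tensorDelta T k) * ∑ j : {j // j ≠ k}, ∑ a, |x j a - y j a| := by
  have hD := one_sub_tensorDelta_nonneg hT hn
  have hzero : ∑ b, (tensorMarginal T x k b - tensorMarginal T y k b) = 0 := by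
    rw [Finset.sum_sub_distrib, (tensorMarginal_mem_stdSimplex hpos hT (hn k) hx).2,
      (tensorMarginal_mem_stdSimplex hpos hT (hn k) hy).2, sub_self]
  rw [sum_abs_eq_two_mul_sum_filter hzero]
  set V : Finset (Fin (n k)) :=
    {b | 0 ≤ tensorMarginal T x k b - tensorMarginal T y k b}
  have hsum : ∑ b ∈ V, (tensorMarginal T x k b - tensorMarginal T y k b) =
      ∑ i : ∀ j : {j // j ≠ k}, Fin (n j), (∑ b ∈ V, T (profileInsert k b i)) *
        (∏ j : {j // j ≠ k}, x j (i j) - ∏ j : {j // j ≠ k}, y j (i j)) := by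
    simp only [tensorMarginal_eq_sum, ← Finset.sum_sub_distrib, ← mul_sub]
    rw [Finset.sum_comm]
    simp only [Finset.sum_mul]
  have hosc (i i' : ∀ j : {j // j ≠ k}, Fin (n j)) :
      ∑ b ∈ V, T (profileInsert k b i) - ∑ b ∈ V, T (profileInsert k b i') ≤
        1 - tensorDelta T k := by
    simpa only [update_profileInsert] using sum_update_sub_sum_update_le hT V
      (profileInsert k ⟨0, hn k⟩ i) (profileInsert k ⟨0, hn k⟩ i')
  have hmass : ∑ i : ∀ j : {j // j ≠ k}, Fin (n j),
      (∏ j : {j // j ≠ k}, x j (i j) - ∏ j : {j // j ≠ k}, y j (i j)) = 0 := by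
    rw [Finset.sum_sub_distrib, sum_prod_eq_one hx, sum_prod_eq_one hy, sub_self]
  have hbound := sum_mul_le_half_oscillation hosc hmass
  have hdist : ∑ i : ∀ j : {j // j ≠ k}, Fin (n j),
      |∏ j : {j // j ≠ k}, x j (i j) - ∏ j : {j // j ≠ k}, y j (i j)| ≤
        ∑ j : {j // j ≠ k}, ∑ a, |x j a - y j a| := by
    convert sum_abs_prod_sub_prod_le
      (fun j : {j // j ≠ k} => hx j) fun j : {j // j ≠ k} => hy j
  have hprod := mul_le_mul_of_nonneg_left hdist hD
  rw [hsum]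
  linarith

end Tensor

/-- A maximizer of a nonzero nonnegative linear functional over the nonnegative part of the unit
sphere is proportional to it. -/
lemma eq_smul_of_forall_sum_mul_le {ι : Type*} [Fintype ι] {g u : ι → ℝ} (hg : ∀ i, 0 ≤ g i)
    (hg0 : g ≠ 0) (hu : ∑ i, u i ^ 2 = 1)
    (hmax : ∀ z : ι → ℝ, (∀ i, 0 ≤ z i) → ∑ i, z i ^ 2 = 1 →
      ∑ i, g i * z i ≤ ∑ i, g i * u i) :
    ∃ c : ℝ, u = c • g := by
  set r := √(∑ i, g i ^ 2)
  have hsq : r ^ 2 = ∑ i, g i ^ 2 := Real.sq_sqrt (Finset.sum_nonneg fun i _ => sq_nonneg _)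
  have hrpos : 0 < r := by
    obtain ⟨i, hi⟩ := Function.ne_iff.1 hg0
    exact Real.sqrt_pos.2 (Finset.sum_pos' (fun i _ => sq_nonneg _)
      ⟨i, Finset.mem_univ i, pow_pos ((hg i).lt_of_ne' hi) 2⟩)
  have hopt := hmax (fun i => r⁻¹ * g i) (fun i => mul_nonneg (inv_nonneg.2 hrpos.le) (hg i)) (by
    simp only [mul_pow, ← Finset.mul_sum, ← hsq]
    field_simp)
  have hval : ∑ i, g i * (r⁻¹ * g i) = r := by
    have h : ∀ i, g i * (r⁻¹ * g i) = r⁻¹ * g i ^ 2 := fun i => by ring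
    simp only [h, ← Finset.mul_sum, ← hsq]
    field_simp
  rw [hval] at hopt
  have hdist : ∑ i, (u i - r⁻¹ * g i) ^ 2 = 2 - 2 * r⁻¹ * ∑ i, g i * u i := by
    have h : ∀ i, (u i - r⁻¹ * g i) ^ 2 =
        u i ^ 2 + r⁻¹ ^ 2 * g i ^ 2 - 2 * r⁻¹ * (g i * u i) := fun i => by ring
    simp only [h, Finset.sum_sub_distrib, Finset.sum_add_distrib, ← Finset.mul_sum, hu, ← hsq]
    field_simp
    ring
  have hle : ∑ i, (u i - r⁻¹ * g i) ^ 2 ≤ 0 := by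
    have h := mul_le_mul_of_nonneg_left hopt (inv_nonneg.2 hrpos.le)
    rw [inv_mul_cancel₀ hrpos.ne'] at h
    linarith
  have hzero := (Finset.sum_eq_zero_iff_of_nonneg fun i _ => sq_nonneg (u i - r⁻¹ * g i)).1
    (hle.antisymm (Finset.sum_nonneg fun i _ => sq_nonneg _))
  refine ⟨r⁻¹, funext fun i => ?_⟩
  simpa [sub_eq_zero] using hzero i (Finset.mem_univ i)

/-- Normalizing a nonnegative vector of unit `ℓ2` norm in `ℓ1` gives a probability vector. -/
lemma inv_sum_abs_smul_mem_stdSimplex {ι : Type*} [Fintype ι] {u : ι → ℝ} (hnn : ∀ i, 0 ≤ u i)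
    (hpos : 0 < ∑ i, |u i|) : (∑ i, |u i|)⁻¹ • u ∈ stdSimplex ℝ ι := by
  refine ⟨fun i => mul_nonneg (inv_nonneg.2 hpos.le) (hnn i), ?_⟩
  simp only [abs_of_nonneg (hnn _)] at hpos ⊢
  simp only [Pi.smul_apply, smul_eq_mul, ← Finset.mul_sum, inv_mul_cancel₀ hpos.ne']

/-- The `ℓ1`-normalized Nash equilibrium of a normalized Markov game is fixed by the marginal
map. -/
lemma tensorMarginal_eq_of_nash {m : ℕ} {n : Fin m → ℕ} {T : (∀ j, Fin (n j)) → ℝ} {k : Fin m}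
    (hpos : ∀ i, 0 < T i) (hT : ∀ i, ∑ b, T (Function.update i k b) = 1) (hn : 0 < n k)
    {c : Fin m → ℝ} {u : ∀ k, Fin (n k) → ℝ} (hc : ∀ j, 0 < c j)
    (hsimplex : ∀ j, c j • u j ∈ stdSimplex ℝ (Fin (n j))) (hu : ∑ i, u k i ^ 2 = 1)
    (hmax : ∀ z : Fin (n k) → ℝ, (∀ i, 0 ≤ z i) → ∑ i, z i ^ 2 = 1 →
      tensorPayoff T (Function.update u k z) ≤ tensorPayoff T u) :
    tensorMarginal T (fun j => c j • u j) k = c k • u k := by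
  have hg := tensorMarginal_mem_stdSimplex hpos hT hn hsimplex
  have hP : 0 < ∏ j ∈ Finset.univ.erase k, c j := Finset.prod_pos fun j _ => hc j
  have hpay : ∀ z : Fin (n k) → ℝ,
      ∑ b, tensorMarginal T (fun j => c j • u j) k b * z b =
        (∏ j ∈ Finset.univ.erase k, c j) * tensorPayoff T (Function.update u k z) := by
    intro z
    simp only [tensorPayoff_update, tensorMarginal_smul, mul_assoc, Finset.mul_sum]
  obtain ⟨r, hr⟩ := eq_smul_of_forall_sum_mul_le hg.1
    (fun h => by simpa [h] using hg.2) hu (fun z hz hz1 => by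
      rw [hpay, hpay, Function.update_eq_self]
      exact mul_le_mul_of_nonneg_left (hmax z hz hz1) hP.le)
  have hsum := (hsimplex k).2
  have hone : c k * r = 1 := by
    rw [hr] at hsum
    simpa [← Finset.mul_sum, hg.2] using hsum
  rw [hr, smul_smul, hone, one_smul]

/-- in a normalized Markov `m`-player positive unit-sphere game with
`δ_k > (m−2)/(m−1)` for all `k`, Cournot adjustment started from the uniform
profile and iterated via the marginal map `f` satisfies, with
`δ = max_k (1 − δ_k)` and `ε₀ = max_k ‖x⁰_k − x*_k‖₁`,
`max_k ‖x^t_k − x*_k‖₁ ≤ (m−1)^t·δ^t·ε₀` for all `t`, where `x*` is the tuple of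
ℓ1-normalized strategies of the unique Nash equilibrium; moreover `(m−1)·δ < 1`,
so the iterates converge to `x*` exponentially fast. -/
theorem markov_pusg_cournot_converges {m : ℕ} (hm : 2 ≤ m) {n : Fin m → ℕ}
    (hn : ∀ k, 0 < n k)
    (A : ∀ _ : Fin m, (∀ j, Fin (n j)) → ℝ)
    (hA : ∀ k i, 0 < A k i)
    (hMarkov : ∀ (k : Fin m) (i : ∀ j, Fin (n j)),
      ∑ b : Fin (n k), A k (Function.update i k b) = 1)
    (hdelta : ∀ k, ((m : ℝ) - 2) / ((m : ℝ) - 1) < tensorDelta (A k) k)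
    -- `xne` is the (unique) Nash equilibrium, in ℓ2-unit strategies:
    (xne : ∀ k, Fin (n k) → ℝ)
    (hxnenn : ∀ k i, 0 ≤ xne k i) (hxneunit : ∀ k, ∑ i, xne k i ^ 2 = 1)
    (hxneNE : ∀ k, ∀ z : Fin (n k) → ℝ, (∀ i, 0 ≤ z i) → ∑ i, z i ^ 2 = 1 →
      tensorPayoff (A k) (Function.update xne k z) ≤ tensorPayoff (A k) xne)
    -- `xstar` is its tuple of ℓ1-normalized strategies:
    (xstar : ∀ k, Fin (n k) → ℝ)
    (hxstar : ∀ k, xstar k = (∑ i, |xne k i|)⁻¹ • xne k)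
    -- the Cournot adjustment sequence, started from the uniform profile:
    (X : ℕ → ∀ k, Fin (n k) → ℝ)
    (hX0 : ∀ k i, X 0 k i = 1 / (n k : ℝ))
    (hXstep : ∀ t k b, X (t + 1) k b = tensorMarginal (A k) (X t) k b) :
    ((m : ℝ) - 1) * (⨆ k, (1 - tensorDelta (A k) k)) < 1 ∧
    ∀ t, (⨆ k, ∑ i, |X t k i - xstar k i|) ≤
      ((m : ℝ) - 1) ^ t * (⨆ k, (1 - tensorDelta (A k) k)) ^ t *
        (⨆ k, ∑ i, |X 0 k i - xstar k i|) := by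
  have hm2 : (2 : ℝ) ≤ m := by exact_mod_cast hm
  have hm1 : (0 : ℝ) < (m : ℝ) - 1 := by linarith
  have : Nonempty (Fin m) := ⟨⟨0, by omega⟩⟩
  have hbdd (f : Fin m → ℝ) : BddAbove (Set.range f) := (Set.finite_range f).bddAbove
  set D := ⨆ k, (1 - tensorDelta (A k) k) with hDdef
  refine ⟨?_, ?_⟩
  · obtain ⟨k, hk⟩ := exists_eq_ciSup_of_finite (f := fun k => 1 - tensorDelta (A k) k)
    rw [hDdef, ← hk]
    have h := (div_lt_iff₀ hm1).1 (hdelta k)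
    linarith
  have hspos (k : Fin m) : 0 < ∑ i, |xne k i| := by
    refine (Finset.sum_nonneg fun i _ => abs_nonneg _).lt_of_ne' fun h => ?_
    have hz := (Finset.sum_eq_zero_iff_of_nonneg fun i _ => abs_nonneg (xne k i)).1 h
    have hunit := hxneunit k
    rw [Finset.sum_eq_zero fun i hi => by simp [abs_eq_zero.1 (hz i hi)]] at hunit
    exact zero_ne_one hunit
  have hsimplex (k : Fin m) := inv_sum_abs_smul_mem_stdSimplex (hxnenn k) (hspos k)
  have hxs : xstar = fun k => (∑ i, |xne k i|)⁻¹ • xne k := funext hxstar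
  have hstar (k : Fin m) : xstar k ∈ stdSimplex ℝ (Fin (n k)) := by
    rw [hxstar]
    exact hsimplex k
  have hfix (k : Fin m) : tensorMarginal (A k) xstar k = xstar k := by
    rw [hxs]
    exact tensorMarginal_eq_of_nash (hA k) (hMarkov k) (hn k) (fun j => inv_pos.2 (hspos j))
      hsimplex (hxneunit k) (hxneNE k)
  have hX (t : ℕ) : ∀ k, X t k ∈ stdSimplex ℝ (Fin (n k)) := by
    induction t with
    | zero =>
      refine fun k => ⟨fun i => by rw [hX0]; positivity, ?_⟩
      have : (n k : ℝ) ≠ 0 := by exact_mod_cast (hn k).ne'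
      simp only [hX0, Finset.sum_const, Finset.card_univ, Fintype.card_fin, nsmul_eq_mul]
      field_simp
    | succ t ih =>
      intro k
      rw [funext (hXstep t k)]
      exact tensorMarginal_mem_stdSimplex (hA k) (hMarkov k) (hn k) ih
  have hD (k : Fin m) : 0 ≤ 1 - tensorDelta (A k) k :=
    one_sub_tensorDelta_nonneg (hMarkov k) hn
  have hDle (k : Fin m) : 1 - tensorDelta (A k) k ≤ D :=
    le_ciSup (hbdd fun k => 1 - tensorDelta (A k) k) k
  have hstep (t : ℕ) : (⨆ k, ∑ i, |X (t + 1) k i - xstar k i|) ≤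
      ((m : ℝ) - 1) * D * ⨆ k, ∑ i, |X t k i - xstar k i| := by
    refine ciSup_le fun k => ?_
    have hlip := sum_abs_tensorMarginal_sub_le (hA k) (hMarkov k) hn (hX t) hstar
    simp only [hfix, ← hXstep] at hlip
    have hcard : ((Fintype.card {j // j ≠ k} : ℕ) : ℝ) = (m : ℝ) - 1 := by
      rw [Fintype.card_subtype_compl, Fintype.card_fin, Fintype.card_unique,
        Nat.cast_sub (by omega), Nat.cast_one]
    have hsum : ∑ j : {j // j ≠ k}, ∑ a, |X t j a - xstar j a| ≤
        ((m : ℝ) - 1) * ⨆ k, ∑ i, |X t k i - xstar k i| := by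
      rw [← hcard, ← nsmul_eq_mul]
      exact Finset.sum_le_card_nsmul _ _ _ fun j _ =>
        le_ciSup (hbdd fun k => ∑ i, |X t k i - xstar k i|) j
    calc _ ≤ _ := hlip
      _ ≤ D * (((m : ℝ) - 1) * ⨆ k, ∑ i, |X t k i - xstar k i|) :=
        mul_le_mul (hDle k) hsum (by positivity) ((hD k).trans (hDle k))
      _ = _ := by ring
  have hD0 : 0 ≤ D := (hD ⟨0, by omega⟩).trans (hDle _)
  intro t
  induction t with
  | zero => simp
  | succ t ih =>
    refine (hstep t).trans ((mul_le_mul_of_nonneg_left ih (mul_nonneg hm1.le hD0)).trans_eq ?_)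
    ring
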